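/- Let m ≥ 1. The subsemigroup of S(m,m) generated by the elements p_i = x^{i-1} y (for 1 ≤ i ≤ m) and r = x^m is presented by ⟨p_1, …, p_m, r | p_i r = r p_i for all i⟩; consequently it is isomorphic to the direct product {p_1,…,p_m}^* × (ℕ ∪ {0}) with the identity element (ε, 0) removed. -/

import Mathlib

/-- The defining relation of the Baumslag–Solitar semigroup `S(m,n)`:
`y x^m = x^n y`, as a binary relation on the free monoid on two generators
(`0` stands for `x`, `1` stands for `y`).  Since the two sides of the relation
are nonempty words, equalities between nonempty words in the quotient monoid
coincide with equalities in the presented semigroup. -/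
def BSrel (m n : ℕ) : FreeMonoid (Fin 2) → FreeMonoid (Fin 2) → Prop := fun a b =>
  a = FreeMonoid.of 1 * (FreeMonoid.of 0) ^ m ∧ b = (FreeMonoid.of 0) ^ n * FreeMonoid.of 1

/-- The Baumslag–Solitar semigroup `S(m,n)` (inside the presented monoid). -/
abbrev BS (m n : ℕ) := (conGen (BSrel m n)).Quotient

/-- The element `x` of `S(m,n)`. -/
def BSx (m n : ℕ) : BS m n := (conGen (BSrel m n)).mk' (FreeMonoid.of 0)

/-- The element `y` of `S(m,n)`. -/
def BSy (m n : ℕ) : BS m n := (conGen (BSrel m n)).mk' (FreeMonoid.of 1)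

/-- The relation `p_i r = r p_i` on the free semigroup over the alphabet
`{p_1, …, p_m, r}` (encoded as `Option (Fin m)`, with `some i = p_{i+1}` and
`none = r`). -/
def CommRel (m : ℕ) :
    FreeSemigroup (Option (Fin m)) → FreeSemigroup (Option (Fin m)) → Prop := fun a b =>
  ∃ i : Fin m, a = FreeSemigroup.of (some i) * FreeSemigroup.of none ∧
    b = FreeSemigroup.of none * FreeSemigroup.of (some i)

/-- The homomorphism `(w, n) ↦ p(w) r ^ n` determined by letters `p i` commuting with `r`. -/
def evalProd {ι N : Type*} [Monoid N] (p : ι → N) (r : N) (h : ∀ i, Commute (p i) r) :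
    FreeMonoid ι × Multiplicative ℕ →* N :=
  MonoidHom.noncommCoprod (FreeMonoid.lift p) (powersHom N r) fun w n => by
    induction w using FreeMonoid.inductionOn' with
    | one => simp
    | of_mul i w ih =>
      rw [map_mul, FreeMonoid.lift_eval_of, powersHom_apply]
      rw [powersHom_apply] at ih
      exact ((h i).pow_right _).mul_left ih

section evalProd

variable {ι N : Type*} [Monoid N] (p : ι → N) (r : N) (h : ∀ i, Commute (p i) r)

theorem evalProd_apply (w : FreeMonoid ι) (n : Multiplicative ℕ) :
    evalProd p r h (w, n) = FreeMonoid.lift p w * r ^ n.toAdd := by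
  simp [evalProd]

theorem evalProd_of (i : ι) : evalProd p r h (FreeMonoid.of i, 1) = p i := by
  simp [evalProd_apply]

theorem evalProd_ofAdd_one : evalProd p r h (1, Multiplicative.ofAdd 1) = r := by
  simp [evalProd_apply]

end evalProd

/-- Two homomorphisms out of `FreeMonoid ι × Multiplicative ℕ` agreeing on the generators
are equal. -/
theorem hom_prod_ext {ι N : Type*} [Monoid N] {f g : FreeMonoid ι × Multiplicative ℕ →* N}
    (hp : ∀ i, f (FreeMonoid.of i, 1) = g (FreeMonoid.of i, 1))
    (hr : f (1, Multiplicative.ofAdd 1) = g (1, Multiplicative.ofAdd 1)) : f = g := by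
  have h₁ : f.comp (MonoidHom.inl _ _) = g.comp (MonoidHom.inl _ _) := FreeMonoid.hom_eq hp
  have h₂ : f.comp (MonoidHom.inr _ _) = g.comp (MonoidHom.inr _ _) := by
    ext
    exact hr
  rw [← MonoidHom.noncommCoprod_unique f, ← MonoidHom.noncommCoprod_unique g]
  simp only [h₁, h₂]

/-- The semigroup `⟨p_1, …, p_m, r | p_i r = r p_i⟩`. -/
abbrev CommPres (m : ℕ) := (conGen (CommRel m)).Quotient

namespace CommPres

variable {m : ℕ}

/-- A generator of `CommPres m`. -/
def gen (a : Option (Fin m)) : CommPres m := (FreeSemigroup.of a : FreeSemigroup (Option (Fin m)))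

theorem gen_comm (i : Fin m) : gen (some i) * gen none = gen none * gen (some i) :=
  (Con.eq _).2 (ConGen.Rel.of _ _ ⟨i, rfl, rfl⟩)

theorem gen_induction {P : CommPres m → Prop} (hgen : ∀ a, P (gen a))
    (hmul : ∀ a q, P (gen a) → P q → P (gen a * q)) (q : CommPres m) : P q := by
  induction q using Con.induction_on with
  | _ w =>
    induction w using FreeSemigroup.recOnMul with
    | ih1 a => exact hgen a
    | ih2 a w ha hw => exact hmul a _ ha hw

/-- The universal property of `CommPres m`. -/
def lift {S : Type*} [Semigroup S] (p : Option (Fin m) → S)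
    (h : ∀ i, p (some i) * p none = p none * p (some i)) : CommPres m →ₙ* S where
  toFun q := Con.liftOn q (FreeSemigroup.lift p) fun a b hab => by
    have hle : conGen (CommRel m) ≤ Con.ker (FreeSemigroup.lift p) := by
      rw [Con.conGen_le]
      rintro _ _ ⟨i, rfl, rfl⟩
      simpa [Con.ker_rel] using h i
    exact hle hab
  map_mul' a b := by
    induction a, b using Con.induction_on₂ with
    | _ a b => exact map_mul (FreeSemigroup.lift p) a b

/-- The homomorphism sending `p_i` to the `i`-th letter and `r` to `1 ∈ ℕ`. -/
def toProd : CommPres m →ₙ* FreeMonoid (Fin m) × Multiplicative ℕ :=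
  lift (fun a => a.elim (1, Multiplicative.ofAdd 1) fun i => (FreeMonoid.of i, 1))
    fun i => by simp

theorem toProd_some (i : Fin m) : toProd (gen (some i)) = (FreeMonoid.of i, 1) := rfl

theorem toProd_none : toProd (gen (none : Option (Fin m))) = (1, Multiplicative.ofAdd 1) := rfl

/-- The inverse of `toProd` after an identity is adjoined. -/
def ofProd : FreeMonoid (Fin m) × Multiplicative ℕ →* WithOne (CommPres m) :=
  evalProd (fun i => (gen (some i) : WithOne (CommPres m)))
    ((gen none : CommPres m) : WithOne (CommPres m)) fun i => by
    rw [commute_iff_eq, ← WithOne.coe_mul, gen_comm, WithOne.coe_mul]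

theorem ofProd_toProd (q : CommPres m) : ofProd (toProd q) = (q : WithOne (CommPres m)) := by
  have hgen (a : Option (Fin m)) : ofProd (toProd (gen a)) = (gen a : WithOne (CommPres m)) := by
    cases a with
    | none => exact evalProd_ofAdd_one _ _ _
    | some i => exact evalProd_of _ _ _ i
  induction q using gen_induction with
  | hgen a => exact hgen a
  | hmul a q ha hq => rw [map_mul, map_mul, ha, hq, WithOne.coe_mul]

theorem lift_toProd_ofProd (z : FreeMonoid (Fin m) × Multiplicative ℕ) :
    WithOne.lift toProd (ofProd z) = z := by
  have : (WithOne.lift toProd).comp ofProd =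
      MonoidHom.id (FreeMonoid (Fin m) × Multiplicative ℕ) := by
    refine hom_prod_ext (fun i => ?_) ?_
    · simp [ofProd, evalProd_of, toProd_some]
    · simp [ofProd, evalProd_ofAdd_one, toProd_none]
  exact DFunLike.congr_fun this z

theorem toProd_injective : Function.Injective (toProd (m := m)) := fun a b hab =>
  WithOne.coe_injective (by rw [← ofProd_toProd, hab, ofProd_toProd])

theorem range_toProd : Set.range (toProd (m := m)) = {z | z ≠ 1} := by
  ext z
  constructor
  · rintro ⟨q, rfl⟩ hq
    have := ofProd_toProd q
    rw [hq, map_one] at this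
    exact WithOne.one_ne_coe this
  · intro hz
    have hne : ofProd z ≠ 1 := fun h => hz (by rw [← lift_toProd_ofProd z, h, map_one])
    obtain ⟨q, hq⟩ := WithOne.ne_one_iff_exists.1 hne
    exact ⟨q, by rw [← lift_toProd_ofProd z, ← hq, WithOne.lift_coe]⟩

end CommPres

theorem BSy_mul_pow (m n : ℕ) : BSy m n * BSx m n ^ m = BSx m n ^ n * BSy m n := by
  have : (conGen (BSrel m n)) (FreeMonoid.of 1 * (FreeMonoid.of 0) ^ m)
      ((FreeMonoid.of 0) ^ n * FreeMonoid.of 1) := ConGen.Rel.of _ _ ⟨rfl, rfl⟩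
  simp only [BSx, BSy, ← map_pow, ← map_mul]
  exact (Con.eq _).2 this

theorem BS_commute (m i : ℕ) : Commute (BSx m m ^ i * BSy m m) (BSx m m ^ m) :=
  ((Commute.refl _).pow_pow i m).mul_left (BSy_mul_pow m m)

/-- The homomorphism `(w, n) ↦ p(w) r ^ n` into `S(m,m)`. -/
def prodToBS (m : ℕ) : FreeMonoid (Fin m) × Multiplicative ℕ →* BS m m :=
  evalProd (fun i => BSx m m ^ (i : ℕ) * BSy m m) (BSx m m ^ m) fun i => BS_commute m i

theorem end_mul_apply {α : Type*} (f g : Function.End α) (a : α) : (f * g) a = f (g a) := rfl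

theorem end_one_apply {α : Type*} (a : α) : (1 : Function.End α) a = a := rfl

/-- Adds `1` to the first entry of a list, if there is one. -/
def incrHead {m : ℕ} : Function.End (List (ZMod m)) := fun l => l.modifyHead (· + 1)

/-- Puts `0` in front of a list. -/
def consZero {m : ℕ} : Function.End (List (ZMod m)) := fun l => 0 :: l

theorem incrHead_pow {m : ℕ} (k : ℕ) (l : List (ZMod m)) :
    (incrHead ^ k) l = l.modifyHead (· + (k : ZMod m)) := by
  induction k with
  | zero => cases l <;> simp [end_one_apply]
  | succ k ih =>
    rw [pow_succ', end_mul_apply, ih]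
    cases l <;> simp [incrHead, add_assoc]

theorem incrHead_pow_self (m : ℕ) : (incrHead : Function.End (List (ZMod m))) ^ m = 1 := by
  funext l
  rw [incrHead_pow]
  cases l <;> simp [end_one_apply]

/-- The action of `S(m,m)` on lists of residues: `x` increments the head and `y` puts a `0` in
front. -/
def BSact (m : ℕ) : BS m m →* Function.End (List (ZMod m)) :=
  Con.lift _ (FreeMonoid.lift ![incrHead, consZero]) <| by
    rw [Con.conGen_le]
    rintro _ _ ⟨rfl, rfl⟩
    simp [Con.ker_rel, incrHead_pow_self]

theorem BSact_x (m : ℕ) : BSact m (BSx m m) = incrHead := rfl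

theorem BSact_y (m : ℕ) : BSact m (BSy m m) = consZero := rfl

/-- The number of occurrences of `x` in an element of `S(m,m)`. -/
def BScount (m : ℕ) : BS m m →* Multiplicative ℕ :=
  Con.lift _ (FreeMonoid.lift ![Multiplicative.ofAdd 1, 1]) <| by
    rw [Con.conGen_le]
    rintro _ _ ⟨rfl, rfl⟩
    simp [Con.ker_rel]

theorem BScount_x (m : ℕ) : BScount m (BSx m m) = Multiplicative.ofAdd 1 := rfl

theorem BSact_prodToBS {m : ℕ} (w : FreeMonoid (Fin m)) (n : Multiplicative ℕ) :
    BSact m (prodToBS m (w, n)) [] = w.toList.map fun i : Fin m => ((i : ℕ) : ZMod m) := by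
  rw [prodToBS, evalProd_apply, map_mul, map_pow, map_pow, BSact_x, incrHead_pow_self, one_pow,
    mul_one]
  induction w using FreeMonoid.inductionOn' with
  | one => simp [end_one_apply]
  | of_mul i w ih =>
    rw [map_mul, map_mul, FreeMonoid.lift_eval_of, map_mul, map_pow, BSact_x, BSact_y,
      end_mul_apply, ih, end_mul_apply,
      incrHead_pow]
    simp [consZero]

theorem prodToBS_injective {m : ℕ} (hm : 1 ≤ m) : Function.Injective (prodToBS m) := by
  rintro ⟨w, n⟩ ⟨w', n'⟩ h
  have hcast : Function.Injective fun i : Fin m => ((i : ℕ) : ZMod m) := fun i j hij => by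
    have := (ZMod.natCast_eq_natCast_iff' _ _ _).1 hij
    rw [Nat.mod_eq_of_lt i.2, Nat.mod_eq_of_lt j.2] at this
    exact Fin.ext this
  obtain rfl : w = w' := by
    have := congrArg (fun b => BSact m b []) h
    simp only [BSact_prodToBS] at this
    exact FreeMonoid.toList.injective (hcast.list_map this)
  have hn := congrArg (BScount m) h
  rw [prodToBS, evalProd_apply, evalProd_apply, map_mul, map_mul, mul_right_inj, ← pow_mul,
    ← pow_mul, map_pow, map_pow, BScount_x, ← ofAdd_nsmul, ← ofAdd_nsmul, smul_eq_mul,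
    smul_eq_mul, mul_one, mul_one] at hn
  have hn' : m * n.toAdd = m * n'.toAdd := Multiplicative.ofAdd.injective hn
  rw [Prod.mk.injEq]
  exact ⟨rfl, Multiplicative.toAdd.injective (Nat.eq_of_mul_eq_mul_left hm hn')⟩

/-- Let `m ≥ 1`.  The subsemigroup of `S(m,m)` generated by `p_i = x^{i-1} y`
(`1 ≤ i ≤ m`) and `r = x^m` is presented by `⟨p_1,…,p_m,r | p_i r = r p_i⟩`
(the natural map from the presented semigroup is an isomorphism onto this
subsemigroup), and consequently it is isomorphic to the direct product of the
free monoid on `m` letters and `(ℕ ∪ {0}, +)` with the identity `(ε, 0)` removed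
(the presented semigroup maps injectively onto the set of non-identity elements
of `FreeMonoid (Fin m) × Multiplicative ℕ`). -/
theorem stmt8 (m : ℕ) (hm : 1 ≤ m) :
    (∃ f : (conGen (CommRel m)).Quotient →ₙ* BS m m,
      Function.Injective f ∧
      (∀ i : Fin m, f ((FreeSemigroup.of (some i) : FreeSemigroup (Option (Fin m))) :
          (conGen (CommRel m)).Quotient) = (BSx m m) ^ (i : ℕ) * BSy m m) ∧
      f ((FreeSemigroup.of none : FreeSemigroup (Option (Fin m))) :
          (conGen (CommRel m)).Quotient) = (BSx m m) ^ m ∧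
      Set.range f = (Subsemigroup.closure
        (Set.range (fun i : Fin m => (BSx m m) ^ (i : ℕ) * BSy m m) ∪ {(BSx m m) ^ m}) :
          Subsemigroup (BS m m))) ∧
    (∃ g : (conGen (CommRel m)).Quotient →ₙ* FreeMonoid (Fin m) × Multiplicative ℕ,
      Function.Injective g ∧ Set.range g = {p | p ≠ 1}) := by
  have hsome (i : Fin m) : prodToBS m (CommPres.toProd (CommPres.gen (some i))) =
      BSx m m ^ (i : ℕ) * BSy m m := evalProd_of _ _ _ i
  have hnone : prodToBS m (CommPres.toProd (CommPres.gen none)) = BSx m m ^ m :=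
    evalProd_ofAdd_one _ _ _
  refine ⟨⟨(prodToBS m).toMulHom.comp CommPres.toProd,
    (prodToBS_injective hm).comp CommPres.toProd_injective, hsome, hnone, ?_⟩,
    CommPres.toProd, CommPres.toProd_injective, CommPres.range_toProd⟩
  apply Set.Subset.antisymm
  · rintro _ ⟨q, rfl⟩
    induction q using CommPres.gen_induction with
    | hgen a =>
      apply Subsemigroup.subset_closure
      cases a with
      | none => exact Or.inr hnone
      | some i => exact Or.inl ⟨i, (hsome i).symm⟩
    | hmul a q ha hq =>
      rw [map_mul]
      exact mul_mem ha hq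
  · rw [← MulHom.coe_srange, SetLike.coe_subset_coe, Subsemigroup.closure_le]
    rintro _ (⟨i, rfl⟩ | rfl)
    · exact ⟨_, hsome i⟩
    · exact ⟨_, hnone⟩
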